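/- arXiv:1102.3335 — 3 statements merged into one kernel-verified Lean document; each statement's English description precedes it below -/
import Mathlib

section
/- Let c < 0 and h > 0 be real numbers, let S be a symmetric traceless 2×2 real matrix, and let T ∈ ℝ² be a vector with ‖T‖ ≤ 1. If −(1/(8h²))‖S‖² − (c/(4h²))⟨S T, T⟩ − (c²/(16h²))‖T‖⁴ + c(1 − ‖T‖²) + h² ≥ 0, then ‖S‖ ≤ (−c + √(c² + 16h⁴))/√2, where ‖S‖ denotes the Frobenius norm of S (the square root of the sum of the squares of its entries). -/
open Matrix

/-- Bound on the Frobenius norm of `S` in the case `c < 0`. -/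
theorem stmt_10 (c h : ℝ) (hc : c < 0) (hh : 0 < h)
    (S : Matrix (Fin 2) (Fin 2) ℝ) (hS : S.IsSymm) (htr : S.trace = 0)
    (T : Fin 2 → ℝ) (hT : Real.sqrt (T ⬝ᵥ T) ≤ 1)
    (hineq : 0 ≤ -(1 / (8 * h ^ 2)) * (∑ i, ∑ j, S i j ^ 2)
        - (c / (4 * h ^ 2)) * (S.mulVec T ⬝ᵥ T)
        - (c ^ 2 / (16 * h ^ 2)) * (T ⬝ᵥ T) ^ 2
        + c * (1 - (T ⬝ᵥ T)) + h ^ 2) :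
    Real.sqrt (∑ i, ∑ j, S i j ^ 2) ≤ (-c + Real.sqrt (c ^ 2 + 16 * h ^ 4)) / Real.sqrt 2 := by
  have hQ : 0 ≤ T ⬝ᵥ T := by
    simp only [dotProduct, Fin.sum_univ_two]
    nlinarith [sq_nonneg (T 0), sq_nonneg (T 1)]
  have hQ1 : T ⬝ᵥ T ≤ 1 := by simpa using (Real.sqrt_le_iff.mp hT).2
  have h10 : S 1 0 = S 0 1 := hS.apply 0 1
  have h11 : S 1 1 = -S 0 0 := by
    rw [Matrix.trace_fin_two] at htr
    linarith
  set m := Real.sqrt (S 0 0 ^ 2 + S 0 1 ^ 2) with hm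
  have hm0 : 0 ≤ m := Real.sqrt_nonneg _
  have hm2 : m ^ 2 = S 0 0 ^ 2 + S 0 1 ^ 2 := Real.sq_sqrt (by positivity)
  have hN : ∑ i, ∑ j, S i j ^ 2 = 2 * m ^ 2 := by
    simp only [Fin.sum_univ_two, h10, h11, hm2]
    ring
  have hST : S.mulVec T ⬝ᵥ T ≤ m * (T ⬝ᵥ T) := by
    refine (abs_le_of_sq_le_sq' ?_ (mul_nonneg hm0 hQ)).2
    rw [mul_pow, hm2]
    simp only [Matrix.mulVec, dotProduct, Fin.sum_univ_two, h10, h11]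
    nlinarith [sq_nonneg (S 0 1 * (T 0 ^ 2 - T 1 ^ 2) - S 0 0 * (2 * T 0 * T 1))]
  rw [hN] at hineq ⊢
  generalize T ⬝ᵥ T = t at *
  generalize S.mulVec T ⬝ᵥ T = q at *
  have hscaled : 0 ≤ -4 * m ^ 2 - 4 * c * q - c ^ 2 * t ^ 2 + 16 * h ^ 2 * c * (1 - t)
      + 16 * h ^ 4 := by
    have := mul_nonneg (by positivity : (0 : ℝ) ≤ 16 * h ^ 2) hineq
    field_simp at this
    linarith
  have hsq : (2 * m + c * t) ^ 2 ≤ (4 * h ^ 2) ^ 2 := by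
    have h1 : 0 ≤ -c * (m * t - q) := mul_nonneg (by linarith) (by linarith)
    have h2 : 0 ≤ h ^ 2 * (-c * (1 - t)) :=
      mul_nonneg (by positivity) (mul_nonneg (by linarith) (by linarith))
    nlinarith
  have hlin : 2 * m + c * t ≤ 4 * h ^ 2 :=
    (abs_le_of_sq_le_sq' hsq (by positivity)).2
  have hroot : 4 * h ^ 2 ≤ Real.sqrt (c ^ 2 + 16 * h ^ 4) :=
    Real.le_sqrt_of_sq_le (by nlinarith [sq_nonneg c])
  have hct : -(c * t) ≤ -c := by nlinarith
  rw [le_div_iff₀ (by positivity), ← Real.sqrt_mul (by positivity),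
    show 2 * m ^ 2 * 2 = (2 * m) ^ 2 by ring, Real.sqrt_sq (by positivity)]
  linarith
end

section
/- Let c > 0 and h > 0 be real numbers, let S be a symmetric traceless 2×2 real matrix, and let T ∈ ℝ² be a vector with ‖T‖ ≤ 1. If −(1/(8h²))‖S‖² − (c/(4h²))⟨S T, T⟩ − (c²/(16h²))‖T‖⁴ + c(1 − ‖T‖²) + h² ≥ 0, then ‖S‖ ≤ (c + √(c² + 16ch² + 16h⁴))/√2, where ‖S‖ denotes the Frobenius norm of S (the square root of the sum of the squares of its entries). -/
open Matrix

/-- Cauchy–Schwarz bound for the quadratic form of a traceless symmetric `2 × 2` matrix. -/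
lemma neg_quadratic_form_le (a b x y : ℝ) :
    -(a * (x ^ 2 - y ^ 2) + 2 * b * (x * y)) ≤ Real.sqrt (a ^ 2 + b ^ 2) * (x ^ 2 + y ^ 2) := by
  refine (abs_le_of_sq_le_sq' ?_ (by positivity)).2
  rw [mul_pow, Real.sq_sqrt (by positivity)]
  nlinarith [sq_nonneg (b * (x ^ 2 - y ^ 2) - 2 * a * (x * y))]

/-- Bound on the Frobenius norm of `S` in the case `c > 0`. -/
theorem stmt_11 (c h : ℝ) (hc : 0 < c) (hh : 0 < h)
    (S : Matrix (Fin 2) (Fin 2) ℝ) (hS : S.IsSymm) (htr : S.trace = 0)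
    (T : Fin 2 → ℝ) (hT : Real.sqrt (T ⬝ᵥ T) ≤ 1)
    (hineq : 0 ≤ -(1 / (8 * h ^ 2)) * (∑ i, ∑ j, S i j ^ 2)
        - (c / (4 * h ^ 2)) * (S.mulVec T ⬝ᵥ T)
        - (c ^ 2 / (16 * h ^ 2)) * (T ⬝ᵥ T) ^ 2
        + c * (1 - (T ⬝ᵥ T)) + h ^ 2) :
    Real.sqrt (∑ i, ∑ j, S i j ^ 2)
      ≤ (c + Real.sqrt (c ^ 2 + 16 * c * h ^ 2 + 16 * h ^ 4)) / Real.sqrt 2 := by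
  have h10 : S 1 0 = S 0 1 := hS.apply 0 1
  have h11 : S 1 1 = -S 0 0 := by
    rw [Matrix.trace_fin_two] at htr
    linarith
  set r := Real.sqrt (S 0 0 ^ 2 + S 0 1 ^ 2)
  have hr0 : 0 ≤ r := Real.sqrt_nonneg _
  have hr2 : r ^ 2 = S 0 0 ^ 2 + S 0 1 ^ 2 := Real.sq_sqrt (by positivity)
  have hN : ∑ i, ∑ j, S i j ^ 2 = 2 * r ^ 2 := by
    simp only [Fin.sum_univ_two, h10, h11, hr2]
    ring
  have ht : T ⬝ᵥ T = T 0 ^ 2 + T 1 ^ 2 := by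
    simp only [dotProduct, Fin.sum_univ_two]
    ring
  have hq : -(S.mulVec T ⬝ᵥ T) ≤ r * (T ⬝ᵥ T) := by
    have := neg_quadratic_form_le (S 0 0) (S 0 1) (T 0) (T 1)
    simp only [dotProduct, Matrix.mulVec, Fin.sum_univ_two, h10, h11]
    linarith
  have ht0 : 0 ≤ T ⬝ᵥ T := by rw [ht]; positivity
  have ht1 : T ⬝ᵥ T ≤ 1 := by simpa using (Real.sqrt_le_iff.mp hT).2
  rw [hN] at hineq ⊢
  generalize T ⬝ᵥ T = t at *
  generalize S.mulVec T ⬝ᵥ T = q at *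
  have hscaled : 0 ≤ -2 * r ^ 2 - 2 * c * q - c ^ 2 * t ^ 2 / 2
      + 8 * h ^ 2 * c * (1 - t) + 8 * h ^ 4 := by
    have := mul_nonneg (by positivity : 0 ≤ 8 * h ^ 2) hineq
    field_simp at this
    linarith
  have hquad : (2 * r - c) ^ 2 ≤ c ^ 2 + 16 * c * h ^ 2 + 16 * h ^ 4 := by
    have hqr : -q ≤ r := hq.trans (mul_le_of_le_one_right hr0 ht1)
    have h1 : c * -q ≤ c * r := mul_le_mul_of_nonneg_left hqr hc.le
    have h2 : 0 ≤ c ^ 2 * t ^ 2 := by positivity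
    have h3 : 0 ≤ h ^ 2 * c * t := by positivity
    linarith
  have hle := Real.le_sqrt_of_sq_le hquad
  rw [Real.sqrt_mul (by norm_num), Real.sqrt_sq hr0, le_div_iff₀ (by positivity)]
  have h2 : Real.sqrt 2 * Real.sqrt 2 = 2 := Real.mul_self_sqrt (by norm_num)
  linear_combination hle + r * h2
end

section
/- Let f : ℝ² → ℝ be a twice continuously differentiable function that is bounded above and subharmonic, i.e., its Laplacian ∂²f/∂x² + ∂²f/∂y² is non-negative at every point of ℝ². Then f is constant. -/
/-- The second derivative of a function is non-positive at a local maximum. -/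
lemma IsLocalMax.deriv_deriv_nonpos {u : ℝ → ℝ} {a : ℝ} (h : IsLocalMax u a)
    (hc : ContinuousAt u a) : deriv (deriv u) a ≤ 0 := by
  by_contra! hpos
  have hmin : IsLocalMin u a := isLocalMin_of_deriv_deriv_pos hpos h.deriv_eq_zero hc
  have heq : u =ᶠ[nhds a] fun _ => u a := by
    filter_upwards [h, hmin] with x h₁ h₂ using le_antisymm h₁ h₂
  have := heq.deriv.deriv_eq
  simp at this
  linarith

/-- With `q` the squared distance to a point of the plane, `logBarrier q` is strictly superharmonic
away from that point and tends to infinity with `q`. -/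
noncomputable def logBarrier (q : ℝ) : ℝ := Real.log q - q⁻¹

lemma hasDerivAt_logBarrier {q : ℝ} (hq : q ≠ 0) :
    HasDerivAt logBarrier (q⁻¹ + (q ^ 2)⁻¹) q := by
  have := (Real.hasDerivAt_log hq).sub (hasDerivAt_inv hq)
  rwa [sub_neg_eq_add] at this

lemma tendsto_logBarrier_atTop : Filter.Tendsto logBarrier Filter.atTop Filter.atTop := by
  have := Real.tendsto_log_atTop.atTop_add (tendsto_inv_atTop_zero (𝕜 := ℝ)).neg
  exact this.congr fun q => (sub_eq_add_neg _ _).symm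

/-- Second derivative test along a line for a local maximum of a perturbation by `logBarrier`. -/
lemma deriv_deriv_le_of_isLocalMax_sub_logBarrier {F : ℝ → ℝ} (hF : ContDiff ℝ 2 F)
    {ε p c a : ℝ} (hq : 0 < (a - p) ^ 2 + c)
    (hmax : IsLocalMax (fun s => F s - ε * logBarrier ((s - p) ^ 2 + c)) a) :
    deriv (deriv F) a ≤ ε * (2 * (((a - p) ^ 2 + c)⁻¹ + (((a - p) ^ 2 + c) ^ 2)⁻¹)
      - 4 * (a - p) ^ 2 * ((((a - p) ^ 2 + c) ^ 2)⁻¹ + 2 * (((a - p) ^ 2 + c) ^ 3)⁻¹)) := by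
  have hquad (s : ℝ) : HasDerivAt (fun s : ℝ => (s - p) ^ 2 + c) (2 * (s - p)) s := by
    simpa using (((hasDerivAt_id s).sub_const p).pow 2).add_const c
  have hF1 : Differentiable ℝ F := hF.differentiable (by norm_num)
  have hF2 : Differentiable ℝ (deriv F) :=
    (hF.iterate_deriv' 1 1).differentiable (by norm_num)
  have hder (s : ℝ) (hs : 0 < (s - p) ^ 2 + c) :
      HasDerivAt (fun s => F s - ε * logBarrier ((s - p) ^ 2 + c))
        (deriv F s - ε * ((((s - p) ^ 2 + c)⁻¹ + (((s - p) ^ 2 + c) ^ 2)⁻¹) * (2 * (s - p)))) s :=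
    (hF1 s).hasDerivAt.fun_sub
      ((HasDerivAt.comp (h := fun s => (s - p) ^ 2 + c) s
        (hasDerivAt_logBarrier hs.ne') (hquad s)).const_mul ε)
  have hpos : ∀ᶠ s in nhds a, 0 < (s - p) ^ 2 + c :=
    (hquad a).continuousAt.eventually_const_lt hq
  have hderiv : deriv (fun s => F s - ε * logBarrier ((s - p) ^ 2 + c)) =ᶠ[nhds a] fun s =>
      deriv F s - ε * ((((s - p) ^ 2 + c)⁻¹ + (((s - p) ^ 2 + c) ^ 2)⁻¹) * (2 * (s - p))) := by
    filter_upwards [hpos] with s hs using (hder s hs).deriv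
  have hlin : HasDerivAt (fun s : ℝ => 2 * (s - p)) 2 a := by
    simpa using ((hasDerivAt_id a).sub_const p).const_mul 2
  have hsecond := (hF2 a).hasDerivAt.fun_sub (((((hquad a).fun_inv hq.ne').fun_add
    (((hquad a).fun_pow 2).fun_inv (pow_ne_zero 2 hq.ne'))).fun_mul hlin).const_mul ε)
  have hle := hmax.deriv_deriv_nonpos (hder a hq).continuousAt
  rw [hderiv.deriv_eq, hsecond.deriv] at hle
  refine (sub_nonpos.mp hle).trans_eq ?_
  have := hq.ne'
  field_simp
  ring

/-- Outside a disc, a bounded-above subharmonic function is at most its bound on the boundary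
circle plus any positive multiple of the growth of `logBarrier`. -/
lemma le_add_mul_logBarrier_of_subharmonic {f : ℝ → ℝ → ℝ}
    (hf : ContDiff ℝ 2 (fun p : ℝ × ℝ => f p.1 p.2)) {B : ℝ} (hB : ∀ x y, f x y ≤ B)
    (hsub : ∀ x y : ℝ,
      0 ≤ deriv (fun t => deriv (fun s => f s y) t) x
          + deriv (fun t => deriv (fun s => f x s) t) y)
    {x₀ y₀ α M ε : ℝ} (hα : 0 < α) (hε : 0 < ε)
    (hM : ∀ x y, (x - x₀) ^ 2 + (y - y₀) ^ 2 = α → f x y ≤ M)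
    {x y : ℝ} (hxy : α ≤ (x - x₀) ^ 2 + (y - y₀) ^ 2) :
    f x y ≤ M + ε * (logBarrier ((x - x₀) ^ 2 + (y - y₀) ^ 2) - logBarrier α) := by
  obtain ⟨β, hβ, hβq⟩ := ((tendsto_logBarrier_atTop.eventually_ge_atTop
    ((B - M) / ε + logBarrier α)).and
      (Filter.eventually_ge_atTop ((x - x₀) ^ 2 + (y - y₀) ^ 2))).exists
  have hβ' : B - ε * logBarrier β ≤ M - ε * logBarrier α := by
    have := mul_le_mul_of_nonneg_left hβ hε.le
    rw [mul_add, mul_div_cancel₀ _ hε.ne'] at this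
    linarith
  set q : ℝ × ℝ → ℝ := fun p => (p.1 - x₀) ^ 2 + (p.2 - y₀) ^ 2 with hq
  have hqc : Continuous q := by fun_prop
  set g : ℝ × ℝ → ℝ := fun p => f p.1 p.2 - ε * logBarrier (q p) with hg
  have hK : IsCompact (q ⁻¹' Set.Icc α β) := by
    refine Metric.isCompact_of_isClosed_isBounded (isClosed_Icc.preimage hqc)
      ((Metric.isBounded_closedBall (x := (x₀, y₀)) (r := √β)).subset ?_)
    rintro ⟨u, v⟩ ⟨-, h⟩
    simp only [hq] at h
    rw [Metric.mem_closedBall, Prod.dist_eq, max_le_iff, Real.dist_eq, Real.dist_eq]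
    constructor <;> refine Real.abs_le_sqrt ?_ <;> nlinarith [sq_nonneg (u - x₀), sq_nonneg (v - y₀)]
  have hgc : ContinuousOn g (q ⁻¹' Set.Icc α β) := fun p hp =>
    (hf.continuous.continuousAt.sub (continuousAt_const.mul
      ((hasDerivAt_logBarrier (hα.trans_le hp.1).ne').continuousAt.comp
        hqc.continuousAt))).continuousWithinAt
  obtain ⟨⟨a, b⟩, hm, hmax⟩ := hK.exists_isMaxOn ⟨(x, y), hxy, hβq⟩ hgc
  have hxm : g (x, y) ≤ g (a, b) := hmax (show (x, y) ∈ q ⁻¹' Set.Icc α β from ⟨hxy, hβq⟩)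
  suffices g (a, b) ≤ M - ε * logBarrier α by
    have := hxm.trans this
    simp only [hg, hq] at this
    linarith
  rcases hm.1.eq_or_lt with h | h
  · simp only [hg, ← h]
    linarith [hM a b h.symm]
  rcases hm.2.eq_or_lt with h' | h'
  · simp only [hg, h']
    linarith [hB a b]
  exfalso
  have hloc : IsLocalMax g (a, b) :=
    hmax.isLocalMax (Filter.mem_of_superset (hqc.continuousAt.preimage_mem_nhds (Icc_mem_nhds h h'))
      subset_rfl)
  have hpos : 0 < (a - x₀) ^ 2 + (b - y₀) ^ 2 := hα.trans h
  have h₁ := deriv_deriv_le_of_isLocalMax_sub_logBarrier (F := fun s => f s b) (ε := ε) (p := x₀)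
    (c := (b - y₀) ^ 2) (a := a)
    (hf.comp (contDiff_id.prodMk contDiff_const)) hpos
    (hloc.comp_continuous (g := fun s : ℝ => (s, b)) (by fun_prop))
  have h₂ := deriv_deriv_le_of_isLocalMax_sub_logBarrier (F := fun s => f a s) (ε := ε) (p := y₀)
    (c := (a - x₀) ^ 2) (a := b)
    (hf.comp (contDiff_const.prodMk contDiff_id)) (by linarith) (by
      have := hloc.comp_continuous (g := fun s : ℝ => (a, s)) (by fun_prop)
      simpa only [hg, hq, Function.comp_def, add_comm] using this)
  rw [add_comm ((b - y₀) ^ 2)] at h₂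
  have hsum := (hsub a b).trans (add_le_add h₁ h₂)
  have hneg : 0 < 4 * ε * (((a - x₀) ^ 2 + (b - y₀) ^ 2) ^ 2)⁻¹ := by positivity
  refine hneg.not_ge (neg_nonneg.mp (hsum.trans_eq ?_))
  have := hpos.ne'
  field_simp
  ring

/-- A bounded-above `C²` subharmonic function on the plane is constant
(parabolicity of the plane, a result of A. Huber). -/
theorem stmt_12 (f : ℝ → ℝ → ℝ)
    (hf : ContDiff ℝ 2 (fun p : ℝ × ℝ => f p.1 p.2))
    (hbdd : BddAbove (Set.range (fun p : ℝ × ℝ => f p.1 p.2)))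
    (hsub : ∀ x y : ℝ,
      0 ≤ deriv (fun t => deriv (fun s => f s y) t) x
          + deriv (fun t => deriv (fun s => f x s) t) y) :
    ∀ x y x' y' : ℝ, f x y = f x' y' := by
  obtain ⟨B, hB⟩ := hbdd
  have hB' (x y : ℝ) : f x y ≤ B := hB ⟨(x, y), rfl⟩
  suffices h : ∀ x y x₀ y₀ : ℝ, f x y ≤ f x₀ y₀ from
    fun x y x' y' => le_antisymm (h _ _ _ _) (h _ _ _ _)
  intro x y x₀ y₀
  refine le_of_forall_gt_imp_ge_of_dense fun c hc => ?_
  obtain ⟨δ, hδ, hball⟩ := Metric.eventually_nhds_iff.mp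
    ((hf.continuous.tendsto (x₀, y₀)).eventually_lt_const hc)
  have hnear (u v : ℝ) (h : (u - x₀) ^ 2 + (v - y₀) ^ 2 < δ ^ 2) : f u v ≤ c := by
    refine (hball (y := (u, v)) ?_).le
    rw [Prod.dist_eq, max_lt_iff, Real.dist_eq, Real.dist_eq]
    constructor <;> refine abs_lt_of_sq_lt_sq ?_ hδ.le <;>
      nlinarith [sq_nonneg (u - x₀), sq_nonneg (v - y₀)]
  rcases lt_or_ge ((x - x₀) ^ 2 + (y - y₀) ^ 2) (δ ^ 2) with h | h
  · exact hnear x y h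
  have hδ2 : 0 < δ ^ 2 := by positivity
  set D := logBarrier ((x - x₀) ^ 2 + (y - y₀) ^ 2) - logBarrier (δ ^ 2 / 2) with hD
  have hbound (ε : ℝ) (hε : 0 < ε) : f x y ≤ c + ε * D :=
    le_add_mul_logBarrier_of_subharmonic hf hB' hsub (half_pos hδ2) hε
      (fun u v huv => hnear u v (by linarith)) (by linarith)
  have hlim : Filter.Tendsto (fun ε : ℝ => c + ε * D) (nhdsWithin 0 (Set.Ioi 0)) (nhds c) := by
    have : Continuous fun ε : ℝ => c + ε * D := by fun_prop
    simpa using (this.tendsto 0).mono_left nhdsWithin_le_nhds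
  exact ge_of_tendsto hlim (Filter.eventually_of_mem self_mem_nhdsWithin hbound)
end
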